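/- Let α, β ∈ (0,1) and assume min_{ν ≥ 0} √( (1+ν²)·erfc(ν/√2) + (4ν/√(2π))·( 2·e^{−(erfinv(1−β))²} − (1/2)·e^{−ν²/2} ) ) < √α. Then there exists ε > 0 such that for all sufficiently large n, with m = ⌈αn⌉, k = ⌈βn⌉, and A an m×n random matrix with i.i.d. standard normal entries, the probability is at least 1 − e^{−εn} that every x ∈ ℝ^n with at most k nonzero entries is the unique solution of the optimization problem: minimize ‖z‖₁ subject to Az = Ax. -/

import Mathlib

open MeasureTheory ProbabilityTheory

/-- The standard error function `erf x = (2/√π) ∫₀ˣ e^{−t²} dt`. -/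
noncomputable def erf (x : ℝ) : ℝ :=
  (2 / Real.sqrt Real.pi) * ∫ t in (0 : ℝ)..x, Real.exp (-t ^ 2)

/-- The complementary error function. -/
noncomputable def erfc (x : ℝ) : ℝ := 1 - erf x

/-- The inverse of the error function (on `(−1,1)`). -/
noncomputable def erfinv (y : ℝ) : ℝ := Function.invFun erf y

/-- `x` is the unique minimizer of `‖z‖₁` subject to `Az = Ax`. -/
def UniqueL1Min {m n : ℕ} (A : Fin m → Fin n → ℝ) (x : Fin n → ℝ) : Prop :=
  ∀ z : Fin n → ℝ, (∀ i, ∑ j, A i j * z j = ∑ j, A i j * x j) → z ≠ x →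
    ∑ i, |x i| < ∑ i, |z i|

/-- The law of an `m × n` matrix with i.i.d. standard normal entries. -/
noncomputable def matrixGaussian (m n : ℕ) : Measure (Fin m → Fin n → ℝ) :=
  Measure.pi fun _ => Measure.pi fun _ => gaussianReal 0 1


lemma pi_gauss_density (ι : Type) [Fintype ι] :
    (Measure.pi fun _ : ι => gaussianReal 0 1) =
      (volume : Measure (ι → ℝ)).withDensity
        (fun ξ => ENNReal.ofReal (∏ i, gaussianPDFReal 0 1 (ξ i))) := by
  classical
  apply Measure.pi_eq
  intro s hs
  have hint : Integrable (fun ξ : ι → ℝ => ∏ i, gaussianPDFReal 0 1 (ξ i)) volume :=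
    Integrable.fintype_prod (μ := fun _ => volume) (f := fun _ => gaussianPDFReal 0 1)
      (fun i => integrable_gaussianPDFReal 0 1)
  have hms : MeasurableSet (Set.univ.pi s) := MeasurableSet.univ_pi hs
  rw [withDensity_apply _ hms, ← ofReal_integral_eq_lintegral_ofReal hint.integrableOn
    (Filter.Eventually.of_forall fun ξ => Finset.prod_nonneg fun i _ => gaussianPDFReal_nonneg _ _ _)]
  rw [← integral_indicator hms]
  have : (Set.univ.pi s).indicator (fun ξ : ι → ℝ => ∏ i, gaussianPDFReal 0 1 (ξ i)) =
      fun ξ => ∏ i, (s i).indicator (gaussianPDFReal 0 1) (ξ i) := by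
    ext ξ
    by_cases h : ξ ∈ Set.univ.pi s
    · rw [Set.indicator_of_mem h]
      refine Finset.prod_congr rfl fun i _ => ?_
      rw [Set.indicator_of_mem (h i trivial)]
    · rw [Set.indicator_of_notMem h]
      simp only [Set.mem_pi, Set.mem_univ, true_implies, not_forall] at h
      obtain ⟨i, hi⟩ := h
      exact (Finset.prod_eq_zero (Finset.mem_univ i) (Set.indicator_of_notMem hi _)).symm
  rw [this, integral_fintype_prod_volume_eq_prod, ENNReal.ofReal_prod_of_nonneg]
  · refine Finset.prod_congr rfl fun i _ => ?_
    rw [gaussianReal_apply_eq_integral _ one_ne_zero, integral_indicator (hs i)]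
  · intro i _
    exact integral_nonneg fun x => Set.indicator_nonneg (fun _ _ => gaussianPDFReal_nonneg _ _ _) _

lemma integrable_coord {ι : Type} [Fintype ι] (i : ι) :
    Integrable (fun ξ : ι → ℝ => ξ i) (Measure.pi fun _ : ι => gaussianReal 0 1) := by
  have h := (measurePreserving_eval (fun _ : ι => gaussianReal 0 1) i)
  have h2 : Integrable (id : ℝ → ℝ) (gaussianReal 0 1) :=
    (memLp_id_gaussianReal 1).integrable (by simp)
  exact h.integrable_comp_of_integrable h2

lemma integrable_dot {ι : Type} [Fintype ι] (v : ι → ℝ) :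
    Integrable (fun ξ : ι → ℝ => v ⬝ᵥ ξ) (Measure.pi fun _ : ι => gaussianReal 0 1) := by
  unfold dotProduct
  exact integrable_finsetSum _ fun i _ => (integrable_coord i).const_mul _

lemma gauss_ibp {ι : Type} [Fintype ι] (v : ι → ℝ) (H H' : (ι → ℝ) → ℝ) (C : ℝ)
    (hH : Continuous H) (hH' : Continuous H') (hb : ∀ ξ, |H ξ| ≤ C) (hb' : ∀ ξ, |H' ξ| ≤ C)
    (hd : ∀ ξ, HasDerivAt (fun t : ℝ => H (ξ + t • v)) (H' ξ) 0) :
    ∫ ξ, H ξ * (v ⬝ᵥ ξ) ∂(Measure.pi fun _ : ι => gaussianReal 0 1) =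
      ∫ ξ, H' ξ ∂(Measure.pi fun _ : ι => gaussianReal 0 1) := by
  classical
  set ρ : (ι → ℝ) → ℝ := fun ξ => ∏ i, gaussianPDFReal 0 1 (ξ i) with hρ
  have hρ0 : ∀ ξ, 0 ≤ ρ ξ := fun ξ => Finset.prod_nonneg fun i _ => gaussianPDFReal_nonneg _ _ _
  have hpd : Continuous (gaussianPDFReal 0 1) := by
    unfold gaussianPDFReal; fun_prop
  have hρc : Continuous ρ := by rw [hρ]; fun_prop
  have hm : Measurable (fun ξ => ENNReal.ofReal (ρ ξ)) := (hρc.measurable).ennreal_ofReal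
  have key : ∀ g : (ι → ℝ) → ℝ, Integrable g (Measure.pi fun _ : ι => gaussianReal 0 1) →
      Integrable (fun ξ => g ξ * ρ ξ) volume := by
    intro g hg
    rw [pi_gauss_density, integrable_withDensity_iff_integrable_smul' hm (by simp)] at hg
    refine hg.congr (Filter.Eventually.of_forall fun ξ => ?_)
    simp only [smul_eq_mul]
    rw [ENNReal.toReal_ofReal (hρ0 ξ), mul_comm]
  have key2 : ∀ g : (ι → ℝ) → ℝ, ∫ ξ, g ξ ∂(Measure.pi fun _ : ι => gaussianReal 0 1) =
      ∫ ξ, g ξ * ρ ξ := by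
    intro g
    rw [pi_gauss_density, integral_withDensity_eq_integral_toReal_smul hm (by simp)]
    refine integral_congr_ae (Filter.Eventually.of_forall fun ξ => ?_)
    simp only [smul_eq_mul]
    rw [ENNReal.toReal_ofReal (hρ0 ξ), mul_comm]
  have iH : Integrable H (Measure.pi fun _ : ι => gaussianReal 0 1) :=
    Integrable.of_bound hH.aestronglyMeasurable C (Filter.Eventually.of_forall hb)
  have iH' : Integrable H' (Measure.pi fun _ : ι => gaussianReal 0 1) :=
    Integrable.of_bound hH'.aestronglyMeasurable C (Filter.Eventually.of_forall hb')
  have iHv : Integrable (fun ξ => H ξ * (v ⬝ᵥ ξ)) (Measure.pi fun _ : ι => gaussianReal 0 1) :=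
    (integrable_dot v).bdd_mul hH.aestronglyMeasurable (Filter.Eventually.of_forall hb)
  have hpdf : ∀ x : ℝ, HasDerivAt (gaussianPDFReal 0 1) (-(x * gaussianPDFReal 0 1 x)) x := by
    intro x
    unfold gaussianPDFReal
    have := ((((hasDerivAt_id x).sub_const 0).pow 2).neg.div_const (2 * (1:ℝ))).exp.const_mul
      ((√(2 * Real.pi * 1))⁻¹)
    convert! this using 1
    simp
    ring
  have hline : ∀ ξ, HasLineDerivAt ℝ ρ (-(v ⬝ᵥ ξ) * ρ ξ) ξ v := by
    intro ξ
    unfold HasLineDerivAt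
    have h1 : ∀ i ∈ (Finset.univ : Finset ι), HasDerivAt
        (fun t : ℝ => gaussianPDFReal 0 1 ((ξ + t • v) i)) (-(ξ i * gaussianPDFReal 0 1 (ξ i)) * v i) 0 := by
      intro i _
      have h2 : HasDerivAt (fun t : ℝ => (ξ + t • v) i) (v i) 0 := by
        simpa using ((hasDerivAt_id (0:ℝ)).mul_const (v i)).const_add (ξ i)
      have h3 := hpdf ((ξ + (0:ℝ) • v) i)
      have := h3.comp (0:ℝ) h2
      simpa [Function.comp_def] using this
    have := HasDerivAt.fun_finsetProd h1
    convert! this using 1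
    simp only [dotProduct, smul_eq_mul, zero_smul, add_zero, hρ]
    rw [← Finset.sum_neg_distrib, Finset.sum_mul]
    refine Finset.sum_congr rfl fun i hi => ?_
    rw [← Finset.mul_prod_erase _ _ hi]
    ring
  have := integral_bilinear_hasLineDerivAt_right_eq_neg_left_of_integrable
    (μ := (volume : Measure (ι → ℝ))) (f := H) (f' := H') (g := ρ)
    (g' := fun ξ => -(v ⬝ᵥ ξ) * ρ ξ) (v := v) (B := ContinuousLinearMap.mul ℝ ℝ)
    (by simpa using key H' iH')
    (by
      have := (key _ iHv).neg
      refine this.congr (Filter.Eventually.of_forall fun ξ => ?_)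
      simp; ring)
    (by simpa using key H iH)
    (fun ξ _ => hd ξ) (fun ξ _ => hline ξ)
  rw [key2, key2]
  simp only [ContinuousLinearMap.mul_apply'] at this
  rw [← neg_eq_iff_eq_neg, ← integral_neg] at this
  rw [← this]
  refine integral_congr_ae (Filter.Eventually.of_forall fun ξ => ?_)
  simp; ring

lemma gordon_interp {D O ι : Type} [Fintype D] [Fintype O] [Fintype ι]
    (a b : D → O → ι → ℝ) (ε : O → ℝ) (κ : D → D → ℝ)
    (hab : ∀ x o y p, a x o ⬝ᵥ b y p = 0)
    (hne : ∀ x y o p, o ≠ p → b x o ⬝ᵥ b y p - a x o ⬝ᵥ a y p = 0)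
    (heq : ∀ x y o, b x o ⬝ᵥ b y o - a x o ⬝ᵥ a y o = ε o * κ x y)
    (hκ0 : ∀ x, κ x x = 0) (hκ : ∀ x y, 0 ≤ κ x y)
    (f : (O → ℝ) → ℝ) (f' : (O → ℝ) → O → ℝ) (C : ℝ)
    (hfc : Continuous f) (hfc' : Continuous f') (hf0 : ∀ z, 0 ≤ f z) (hf1 : ∀ z, f z ≤ 1)
    (hC : ∀ z o, |f' z o| ≤ C)
    (hf : ∀ (c : ℝ → O → ℝ) (c' : O → ℝ) (t : ℝ), (∀ o, HasDerivAt (fun s => c s o) (c' o) t) →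
      HasDerivAt (fun s => f (c s)) (∑ o, f' (c t) o * c' o) t)
    (hs : ∀ z w, ∑ o, ε o * (f' z o * f' w o) ≤ 0) :
    ∫ ξ, ∏ x, f (fun o => b x o ⬝ᵥ ξ) ∂(Measure.pi fun _ : ι => gaussianReal 0 1) ≤
    ∫ ξ, ∏ x, f (fun o => a x o ⬝ᵥ ξ) ∂(Measure.pi fun _ : ι => gaussianReal 0 1) := by
  classical
  by_cases hO : IsEmpty O
  · have : ∀ z w : O → ℝ, z = w := fun z w => Subsingleton.elim _ _
    refine le_of_eq (integral_congr_ae (Filter.Eventually.of_forall fun ξ => ?_))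
    exact Finset.prod_congr rfl fun x _ => congrArg f (this _ _)
  have hC0 : 0 ≤ C := by
    obtain ⟨o⟩ := not_isEmpty_iff.mp hO
    exact (abs_nonneg _).trans (hC 0 o)
  set γ := (Measure.pi fun _ : ι => gaussianReal 0 1) with hγ
  set L : ℝ → D → O → ι → ℝ := fun θ x o => Real.cos θ • a x o + Real.sin θ • b x o with hL
  set V : ℝ → D → O → ι → ℝ := fun θ x o => -Real.sin θ • a x o + Real.cos θ • b x o with hV
  set Z : ℝ → (ι → ℝ) → D → O → ℝ := fun θ ξ x o => L θ x o ⬝ᵥ ξ with hZ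
  have hLV : ∀ θ x y o p, L θ y p ⬝ᵥ V θ x o =
      if p = o then Real.sin θ * Real.cos θ * (ε o * κ y x) else 0 := by
    intro θ x y o p
    have e1 : L θ y p ⬝ᵥ V θ x o = Real.sin θ * Real.cos θ * (b y p ⬝ᵥ b x o - a y p ⬝ᵥ a x o) := by
      simp only [hL, hV, dotProduct_add, add_dotProduct, smul_dotProduct, dotProduct_smul, smul_eq_mul,
        hab, dotProduct_comm (b y p) (a x o)]
      ring
    rw [e1]
    split_ifs with h
    · subst h; rw [heq]
    · rw [hne _ _ _ _ h, mul_zero]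
  have hdot : ∀ v : ι → ℝ, Continuous (fun ξ : ι → ℝ => v ⬝ᵥ ξ) := by
    intro v; unfold dotProduct; fun_prop
  have hZc : ∀ θ x, Continuous (fun ξ => Z θ ξ x) := by
    intro θ x
    exact continuous_pi fun o => hdot _
  have hfp : ∀ (s : Finset D) (w : D → O → ℝ), 0 ≤ ∏ y ∈ s, f (w y) ∧ ∏ y ∈ s, f (w y) ≤ 1 := by
    intro s w
    exact ⟨Finset.prod_nonneg fun y _ => hf0 _, Finset.prod_le_one (fun y _ => hf0 _) fun y _ => hf1 _⟩
  set G : ℝ → (ι → ℝ) → ℝ := fun θ ξ => ∏ x, f (Z θ ξ x) with hG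
  set G' : ℝ → (ι → ℝ) → ℝ := fun θ ξ => ∑ x, ∑ o,
    ((∏ y ∈ Finset.univ.erase x, f (Z θ ξ y)) * f' (Z θ ξ x) o) * (V θ x o ⬝ᵥ ξ) with hG'
  have hGd : ∀ θ ξ, HasDerivAt (fun θ => G θ ξ) (G' θ ξ) θ := by
    intro θ ξ
    have h1 : ∀ x ∈ (Finset.univ : Finset D), HasDerivAt (fun θ => f (Z θ ξ x))
        (∑ o, f' (Z θ ξ x) o * (V θ x o ⬝ᵥ ξ)) θ := by
      intro x _
      refine hf (fun θ => Z θ ξ x) (fun o => V θ x o ⬝ᵥ ξ) θ fun o => ?_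
      simp only [hZ, hL, hV, add_dotProduct, smul_dotProduct, smul_eq_mul]
      exact ((Real.hasDerivAt_cos θ).mul_const _).add ((Real.hasDerivAt_sin θ).mul_const _)
    have := HasDerivAt.fun_finsetProd h1
    convert! this using 1
    simp only [hG', smul_eq_mul, Finset.mul_sum, mul_assoc]
  have hGcont : ∀ θ, Continuous (G θ) := fun θ =>
    continuous_finsetProd _ fun x _ => hfc.comp (hZc θ x)
  have hHc : ∀ θ x o, Continuous (fun ξ => (∏ y ∈ Finset.univ.erase x, f (Z θ ξ y)) * f' (Z θ ξ x) o) := by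
    intro θ x o
    exact (continuous_finsetProd _ fun y _ => hfc.comp (hZc θ y)).mul
      (((continuous_apply o).comp hfc').comp (hZc θ x))
  have hHb : ∀ θ x o ξ, |(∏ y ∈ Finset.univ.erase x, f (Z θ ξ y)) * f' (Z θ ξ x) o| ≤ C := by
    intro θ x o ξ
    rw [abs_mul, abs_of_nonneg (hfp _ _).1]
    calc _ ≤ 1 * C := by
          gcongr
          · exact (hfp _ _).2
          · exact hC _ _
      _ = C := one_mul C
  have hG'cont : ∀ θ, Continuous (G' θ) := by
    intro θ
    exact continuous_finsetSum _ fun x _ => continuous_finsetSum _ fun o _ => (hHc θ x o).mul (hdot _)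
  set bd : (ι → ℝ) → ℝ := fun ξ => ∑ x, ∑ o, C * (|a x o ⬝ᵥ ξ| + |b x o ⬝ᵥ ξ|) with hbd
  have hbdi : Integrable bd γ := by
    refine integrable_finsetSum _ fun x _ => integrable_finsetSum _ fun o _ => ?_
    exact ((integrable_dot _).abs.add (integrable_dot _).abs).const_mul _
  have hG'b : ∀ θ ξ, |G' θ ξ| ≤ bd ξ := by
    intro θ ξ
    refine (Finset.abs_sum_le_sum_abs _ _).trans (Finset.sum_le_sum fun x _ => ?_)
    refine (Finset.abs_sum_le_sum_abs _ _).trans (Finset.sum_le_sum fun o _ => ?_)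
    rw [abs_mul]
    refine mul_le_mul (hHb θ x o ξ) ?_ (abs_nonneg _) hC0
    simp only [hV, add_dotProduct, smul_dotProduct, smul_eq_mul]
    refine (abs_add_le _ _).trans ?_
    rw [abs_mul, abs_mul, abs_neg]
    have h1 := Real.abs_sin_le_one θ
    have h2 := Real.abs_cos_le_one θ
    have h3 := abs_nonneg (a x o ⬝ᵥ ξ)
    have h4 := abs_nonneg (b x o ⬝ᵥ ξ)
    nlinarith
  have hΦ : ∀ θ, HasDerivAt (fun θ => ∫ ξ, G θ ξ ∂γ) (∫ ξ, G' θ ξ ∂γ) θ := by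
    intro θ
    refine (hasDerivAt_integral_of_dominated_loc_of_deriv_le (bound := bd) (F := G) (F' := G')
      (s := Set.univ) Filter.univ_mem
      (Filter.Eventually.of_forall fun θ => (hGcont θ).aestronglyMeasurable) ?_
      (hG'cont θ).aestronglyMeasurable
      (Filter.Eventually.of_forall fun ξ θ _ => hG'b θ ξ) hbdi
      (Filter.Eventually.of_forall fun ξ θ _ => hGd θ ξ)).2
    refine Integrable.of_bound (hGcont θ).aestronglyMeasurable 1 (Filter.Eventually.of_forall fun ξ => ?_)
    rw [Real.norm_eq_abs, abs_of_nonneg (hfp _ _).1]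
    exact (hfp _ _).2
  -- integrate by parts
  set K : ℝ → D → O → (ι → ℝ) → ℝ := fun θ x o ξ => ∑ y ∈ Finset.univ.erase x,
      (∏ w ∈ (Finset.univ.erase x).erase y, f (Z θ ξ w)) *
        (Real.sin θ * Real.cos θ * κ y x) * (ε o * (f' (Z θ ξ y) o * f' (Z θ ξ x) o)) with hK
  have hKc : ∀ θ x o, Continuous (K θ x o) := by
    intro θ x o
    refine continuous_finsetSum _ fun y _ => ?_
    refine ((continuous_finsetProd _ fun y _ => hfc.comp (hZc θ y)).mul continuous_const).mul ?_
    exact continuous_const.mul ((((continuous_apply o).comp hfc').comp (hZc θ y)).mul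
      (((continuous_apply o).comp hfc').comp (hZc θ x)))
  have hKb : ∀ θ x o, ∃ B, ∀ ξ, |K θ x o ξ| ≤ B := by
    intro θ x o
    refine ⟨∑ y ∈ Finset.univ.erase x, 1 * |Real.sin θ * Real.cos θ * κ y x| * (|ε o| * (C * C)), fun ξ => ?_⟩
    refine (Finset.abs_sum_le_sum_abs _ _).trans (Finset.sum_le_sum fun y _ => ?_)
    rw [abs_mul, abs_mul, abs_mul (ε o), abs_mul (f' _ _), abs_of_nonneg (hfp _ _).1]
    gcongr
    · exact (hfp _ _).2
    · exact hC _ _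
    · exact hC _ _
  have hibp : ∀ θ x o, ∫ ξ, ((∏ y ∈ Finset.univ.erase x, f (Z θ ξ y)) * f' (Z θ ξ x) o) * (V θ x o ⬝ᵥ ξ) ∂γ
      = ∫ ξ, K θ x o ξ ∂γ := by
    intro θ x o
    obtain ⟨B, hB⟩ := hKb θ x o
    refine gauss_ibp (V θ x o) _ _ (max C B) (hHc θ x o) (hKc θ x o)
      (fun ξ => (hHb θ x o ξ).trans (le_max_left _ _)) (fun ξ => (hB ξ).trans (le_max_right _ _)) ?_
    intro ξ
    have hlin : ∀ y p, HasDerivAt (fun t : ℝ => Z θ (ξ + t • V θ x o) y p)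
        (if p = o then Real.sin θ * Real.cos θ * (ε o * κ y x) else 0) 0 := by
      intro y p
      rw [← hLV θ x y o p]
      simp only [hZ, dotProduct_add, dotProduct_smul, smul_eq_mul]
      simpa using ((hasDerivAt_id (0:ℝ)).mul_const (L θ y p ⬝ᵥ V θ x o)).const_add (L θ y p ⬝ᵥ ξ)
    have hconst : ∀ t : ℝ, Z θ (ξ + t • V θ x o) x = Z θ ξ x := by
      intro t
      ext p
      simp only [hZ, dotProduct_add, dotProduct_smul, smul_eq_mul, hLV, hκ0]
      simp
    have h1 : ∀ y ∈ Finset.univ.erase x, HasDerivAt (fun t : ℝ => f (Z θ (ξ + t • V θ x o) y))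
        (Real.sin θ * Real.cos θ * κ y x * (ε o * f' (Z θ ξ y) o)) 0 := by
      intro y _
      have := hf (fun t => Z θ (ξ + t • V θ x o) y) _ 0 (hlin y)
      convert! this using 1
      simp only [zero_smul, add_zero, mul_ite, mul_zero, Finset.sum_ite_eq', Finset.mem_univ, if_true]
      ring
    have h2 := (HasDerivAt.fun_finsetProd h1).mul_const (f' (Z θ ξ x) o)
    simp only [hconst]
    convert! h2 using 1
    simp only [hK, smul_eq_mul, zero_smul, add_zero, Finset.sum_mul]
    refine Finset.sum_congr rfl fun y _ => ?_
    ring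
  have hneg : ∀ θ, 0 ≤ Real.sin θ * Real.cos θ → ∫ ξ, G' θ ξ ∂γ ≤ 0 := by
    intro θ hθ
    have i1 : ∀ x o, Integrable (fun ξ => ((∏ y ∈ Finset.univ.erase x, f (Z θ ξ y)) * f' (Z θ ξ x) o) * (V θ x o ⬝ᵥ ξ)) γ := by
      intro x o
      exact (integrable_dot _).bdd_mul (hHc θ x o).aestronglyMeasurable
        (Filter.Eventually.of_forall (hHb θ x o))
    have i2 : ∀ x o, Integrable (K θ x o) γ := by
      intro x o
      obtain ⟨B, hB⟩ := hKb θ x o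
      exact Integrable.of_bound (hKc θ x o).aestronglyMeasurable B (Filter.Eventually.of_forall hB)
    have e : ∫ ξ, G' θ ξ ∂γ = ∫ ξ, ∑ x, ∑ o, K θ x o ξ ∂γ := by
      simp only [hG']
      rw [integral_finsetSum _ fun x _ => integrable_finsetSum _ fun o _ => i1 x o,
        integral_finsetSum _ fun x _ => integrable_finsetSum _ fun o _ => i2 x o]
      refine Finset.sum_congr rfl fun x _ => ?_
      rw [integral_finsetSum _ fun o _ => i1 x o, integral_finsetSum _ fun o _ => i2 x o]
      exact Finset.sum_congr rfl fun o _ => hibp θ x o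
    rw [e]
    refine integral_nonpos fun ξ => ?_
    refine Finset.sum_nonpos fun x _ => ?_
    simp only [hK]
    rw [Finset.sum_comm]
    refine Finset.sum_nonpos fun y _ => ?_
    rw [← Finset.mul_sum]
    exact mul_nonpos_of_nonneg_of_nonpos
      (mul_nonneg (hfp _ _).1 (mul_nonneg hθ (hκ _ _))) (hs _ _)
  have hanti : AntitoneOn (fun θ => ∫ ξ, G θ ξ ∂γ) (Set.Icc 0 (Real.pi / 2)) := by
    refine antitoneOn_of_deriv_nonpos (convex_Icc _ _)
      (fun θ _ => (hΦ θ).continuousAt.continuousWithinAt)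
      (fun θ _ => (hΦ θ).differentiableAt.differentiableWithinAt) ?_
    intro θ hθ
    rw [interior_Icc] at hθ
    rw [(hΦ θ).deriv]
    apply hneg
    exact mul_nonneg (Real.sin_nonneg_of_nonneg_of_le_pi hθ.1.le (by linarith [hθ.2, Real.pi_pos]))
      (Real.cos_nonneg_of_neg_pi_div_two_le_of_le (by linarith [hθ.1, Real.pi_pos]) hθ.2.le)
  have hp : (0:ℝ) ≤ Real.pi / 2 := by positivity
  have := hanti (Set.left_mem_Icc.2 hp) (Set.right_mem_Icc.2 hp) hp
  simpa [hG, hZ, hL] using this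

lemma exists_transition : ∃ (ψ ψ' : ℝ → ℝ) (C : ℝ), (∀ x, HasDerivAt ψ (ψ' x) x) ∧ Continuous ψ' ∧
    (∀ x, 0 ≤ ψ' x) ∧ (∀ x, ψ' x ≤ C) ∧ (∀ x, 0 ≤ ψ x) ∧ (∀ x, ψ x ≤ 1) ∧
    (∀ x ≤ 0, ψ x = 0) ∧ (∀ x, 1 ≤ x → ψ x = 1) := by
  have hcd : ContDiff ℝ 1 Real.smoothTransition := Real.smoothTransition.contDiff (n := 1)
  have hcont : Continuous (deriv Real.smoothTransition) := hcd.continuous_deriv le_rfl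
  have hmono : ∀ x, 0 ≤ deriv Real.smoothTransition x := fun x => Real.smoothTransition.monotone.deriv_nonneg
  obtain ⟨C, hC⟩ := (isCompact_Icc (a := (0:ℝ)) (b := 1)).bddAbove_image hcont.continuousOn
  refine ⟨Real.smoothTransition, deriv Real.smoothTransition, max C 0,
    fun x => (hcd.differentiable (by norm_num) x).hasDerivAt, hcont, hmono, ?_,
    Real.smoothTransition.nonneg, Real.smoothTransition.le_one,
    fun x hx => Real.smoothTransition.zero_of_nonpos hx,
    fun x hx => Real.smoothTransition.one_of_one_le hx⟩
  intro x
  by_cases h : x ∈ Set.Icc (0:ℝ) 1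
  · exact (hC (Set.mem_image_of_mem _ h)).trans (le_max_left _ _)
  · have : deriv Real.smoothTransition x = 0 := by
      rw [Set.mem_Icc, not_and_or, not_le, not_le] at h
      rcases h with h | h
      · have : Real.smoothTransition =ᶠ[nhds x] fun _ => 0 := by
          filter_upwards [Iio_mem_nhds h] with y hy
          exact Real.smoothTransition.zero_of_nonpos (le_of_lt hy)
        rw [this.deriv_eq]; simp
      · have : Real.smoothTransition =ᶠ[nhds x] fun _ => 1 := by
          filter_upwards [Ioi_mem_nhds h] with y hy
          exact Real.smoothTransition.one_of_one_le (le_of_lt hy)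
        rw [this.deriv_eq]; simp
    rw [this]; exact le_max_right _ _

lemma exists_gordon_fun (m : ℕ) : ∃ (f : (Option (Fin m) → ℝ) → ℝ)
    (f' : (Option (Fin m) → ℝ) → Option (Fin m) → ℝ) (C : ℝ),
    Continuous f ∧ Continuous f' ∧ (∀ z, 0 ≤ f z) ∧ (∀ z, f z ≤ 1) ∧
    (∀ z o, |f' z o| ≤ C) ∧
    (∀ (c : ℝ → Option (Fin m) → ℝ) (c' : Option (Fin m) → ℝ) (t : ℝ),
      (∀ o, HasDerivAt (fun s => c s o) (c' o) t) →
      HasDerivAt (fun s => f (c s)) (∑ o, f' (c t) o * c' o) t) ∧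
    (∀ z w, ∑ o : Option (Fin m), (if o = none then (-1:ℝ) else 1) * (f' z o * f' w o) ≤ 0) ∧
    (∀ z, ∑ i, z (some i) ^ 2 < 1 → z none ≤ -3 → f z = 0) ∧
    (∀ z, 1 ≤ √(∑ i, z (some i) ^ 2) + z none → f z = 1) := by
  obtain ⟨ψ, ψ', C, hψ, hψ'c, hψ'0, hψ'C, hψ0, hψ1, hψz, hψo⟩ := exists_transition
  have hψc : Continuous ψ := continuous_iff_continuousAt.2 fun x => (hψ x).continuousAt
  set r : (Option (Fin m) → ℝ) → ℝ := fun z => √(1 + ∑ i, z (some i) ^ 2) with hr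
  have hq : ∀ z : Option (Fin m) → ℝ, 0 < 1 + ∑ i, z (some i) ^ 2 := fun z => by
    have : 0 ≤ ∑ i, z (some i) ^ 2 := Finset.sum_nonneg fun i _ => sq_nonneg _
    linarith
  have hr0 : ∀ z, 0 < r z := fun z => Real.sqrt_pos.2 (hq z)
  have hrc : Continuous r := by rw [hr]; fun_prop
  have hzr : ∀ z i, |z (some i)| ≤ r z := by
    intro z i
    refine Real.abs_le_sqrt ?_
    have := Finset.single_le_sum (f := fun i => z (some i) ^ 2) (fun i _ => sq_nonneg _) (Finset.mem_univ i)
    linarith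
  refine ⟨fun z => ψ (r z + z none),
    fun z o => ψ' (r z + z none) * (match o with | none => 1 | some i => z (some i) / r z), C,
    by fun_prop, ?_, fun z => hψ0 _, fun z => hψ1 _, ?_, ?_, ?_, ?_, ?_⟩
  · refine continuous_pi fun o => ?_
    cases o with
    | none => simp only; fun_prop
    | some i =>
      simp only
      refine (hψ'c.comp (by fun_prop)).mul ?_
      exact Continuous.div (by fun_prop) hrc fun z => (hr0 z).ne'
  · intro z o
    rw [abs_mul, abs_of_nonneg (hψ'0 _)]
    have : |(match o with | none => 1 | some i => z (some i) / r z : ℝ)| ≤ 1 := by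
      cases o with
      | none => simp
      | some i => simp only; rw [abs_div, abs_of_pos (hr0 z)]; exact div_le_one_of_le₀ (hzr z i) (hr0 z).le
    calc _ ≤ C * 1 := mul_le_mul (hψ'C _) this (abs_nonneg _) ((hψ'0 0).trans (hψ'C 0))
      _ = C := mul_one C
  · intro c c' t hc
    have h1 : HasDerivAt (fun s => 1 + ∑ i, c s (some i) ^ 2) (∑ i, 2 * c t (some i) * c' (some i)) t := by
      refine HasDerivAt.const_add _ ?_
      refine HasDerivAt.fun_sum fun i _ => ?_
      simpa using (hc (some i)).fun_pow 2
    have h2 := h1.sqrt (hq (c t)).ne'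
    have h3 := (hψ (r (c t) + c t none)).comp t (h2.add (hc none))
    convert! h3 using 1
    rw [Fintype.sum_option, mul_add, add_comm]
    congr 1
    · change _ = _ * (_ / (2 * r (c t)))
      rw [Finset.sum_div, Finset.mul_sum]
      refine Finset.sum_congr rfl fun i _ => ?_
      have := (hr0 (c t)).ne'
      simp only
      field_simp
    · ring
  · intro z w
    rw [Fintype.sum_option]
    have hcs : ∑ i, z (some i) * w (some i) ≤ r z * r w := by
      refine (Real.sum_mul_le_sqrt_mul_sqrt _ _ _).trans ?_
      exact mul_le_mul (Real.sqrt_le_sqrt (by linarith)) (Real.sqrt_le_sqrt (by linarith))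
        (Real.sqrt_nonneg _) (Real.sqrt_nonneg _)
    have h1 : ∑ i, z (some i) / r z * (w (some i) / r w) ≤ 1 := by
      have : ∑ i, z (some i) / r z * (w (some i) / r w) = (∑ i, z (some i) * w (some i)) / (r z * r w) := by
        rw [Finset.sum_div]
        refine Finset.sum_congr rfl fun i _ => ?_
        rw [div_mul_div_comm]
      rw [this]
      exact div_le_one_of_le₀ hcs (mul_nonneg (hr0 z).le (hr0 w).le)
    have h2 : ∑ i : Fin m, (if some i = none then (-1:ℝ) else 1) *
        (ψ' (r z + z none) * (z (some i) / r z) * (ψ' (r w + w none) * (w (some i) / r w))) =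
        ψ' (r z + z none) * ψ' (r w + w none) * ∑ i, z (some i) / r z * (w (some i) / r w) := by
      rw [Finset.mul_sum]
      refine Finset.sum_congr rfl fun i _ => ?_
      simp
      ring
    simp only [if_true] at *
    rw [h2]
    have := mul_nonneg (hψ'0 (r z + z none)) (hψ'0 (r w + w none))
    nlinarith
  · intro z hz hn
    apply hψz
    have : r z ≤ 2 := by
      rw [hr]
      apply Real.sqrt_le_iff.2
      constructor <;> linarith
    linarith
  · intro z hz
    apply hψo
    have : √(∑ i, z (some i) ^ 2) ≤ r z := Real.sqrt_le_sqrt (by linarith)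
    linarith

lemma matrix_curry (m n : ℕ) : MeasurePreserving
    (fun (ξ : (Σ _ : Fin m, Fin n) → ℝ) (i : Fin m) (j : Fin n) => ξ ⟨i, j⟩)
    (Measure.pi fun _ => gaussianReal 0 1) (matrixGaussian m n) := by
  refine ⟨by fun_prop, ?_⟩
  have := Measure.infinitePi_map_piCurry (ι := Fin m) (κ := fun _ => Fin n) (X := fun _ _ => ℝ)
    (fun _ _ => gaussianReal 0 1)
  simp only [Measure.infinitePi_eq_pi] at this
  exact this

lemma pi_marginal {ι κ : Type} [Fintype ι] [Fintype κ] (e : κ → ι) (he : Function.Injective e) :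
    MeasurePreserving (fun (ξ : ι → ℝ) (k : κ) => ξ (e k))
      (Measure.pi fun _ => gaussianReal 0 1) (Measure.pi fun _ => gaussianReal 0 1) := by
  refine ⟨by fun_prop, ?_⟩
  have h1 : iIndepFun (fun (i : ι) (ω : ι → ℝ) => ω i) (Measure.pi fun _ : ι => gaussianReal 0 1) :=
    iIndepFun_pi (X := fun _ x => x) fun i => aemeasurable_id
  have h2 := h1.precomp he
  rw [iIndepFun_iff_map_fun_eq_pi_map (fun i => (measurable_pi_apply _).aemeasurable)] at h2
  rw [h2]
  congr 1
  ext1 k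
  exact (measurePreserving_eval (fun _ : ι => gaussianReal 0 1) (e k)).map_eq

lemma gordon_finite (m n : ℕ) (D : Finset (Fin n → ℝ)) (hD : ∀ x ∈ D, ∑ j, x j ^ 2 = 1)
    (Hb : Set (Fin m → ℝ)) (Gb : Set (Fin n → ℝ)) (hHb : MeasurableSet Hb) (hGb : MeasurableSet Gb)
    (hgood : ∀ h ∉ Hb, ∀ g ∉ Gb, ∀ x ∈ D, 1 ≤ √(∑ i, h i ^ 2) + ∑ j, g j * x j) :
    gaussianReal 0 1 (Set.Iic (-3)) *
      matrixGaussian m n {A | ∃ x ∈ D, ∑ i, (∑ j, A i j * x j) ^ 2 < 1} ≤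
    (Measure.pi fun _ => gaussianReal 0 1) Hb + (Measure.pi fun _ => gaussianReal 0 1) Gb := by
  classical
  obtain ⟨f, f', C, hfc, hfc', hf0, hf1, hC, hf, hs, hfz, hfo⟩ := exists_gordon_fun m
  let ι : Type := (Σ _ : Fin m, Fin n) ⊕ (Unit ⊕ (Fin m ⊕ Fin n))
  let γ : Measure (ι → ℝ) := Measure.pi fun _ => gaussianReal 0 1
  let a : D → Option (Fin m) → ι → ℝ := fun x o => match o with
    | none => Sum.elim 0 (Sum.elim 1 0)
    | some i => Sum.elim (fun q => if q.1 = i then x.1 q.2 else 0) 0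
  let b : D → Option (Fin m) → ι → ℝ := fun x o => match o with
    | none => Sum.elim 0 (Sum.elim 0 (Sum.elim 0 x.1))
    | some i => Sum.elim 0 (Sum.elim 0 (Sum.elim (Pi.single i 1) 0))
  have ha0 : ∀ x (ξ : ι → ℝ), a x none ⬝ᵥ ξ = ξ (.inr (.inl ())) := by
    intro x ξ
    simp [a, dotProduct, ι, Fintype.sum_sum_type]
  have ha1 : ∀ x i (ξ : ι → ℝ), a x (some i) ⬝ᵥ ξ = ∑ j, ξ (.inl ⟨i, j⟩) * x.1 j := by
    intro x i ξ
    simp [a, dotProduct, ι, Fintype.sum_sum_type, Fintype.sum_sigma, mul_comm]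
  have hb0 : ∀ x (ξ : ι → ℝ), b x none ⬝ᵥ ξ = ∑ j, ξ (.inr (.inr (.inr j))) * x.1 j := by
    intro x ξ
    simp [b, dotProduct, ι, Fintype.sum_sum_type, mul_comm]
  have hb1 : ∀ x i (ξ : ι → ℝ), b x (some i) ⬝ᵥ ξ = ξ (.inr (.inr (.inl i))) := by
    intro x i ξ
    simp [b, dotProduct, ι, Fintype.sum_sum_type, Pi.single_apply]
  have main := gordon_interp a b (fun o => if o = none then (-1:ℝ) else 1)
    (fun x y => 1 - ∑ j, x.1 j * y.1 j)
    (by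
      intro x o y p
      cases o with
      | none => rw [ha0 x]; cases p <;> simp [b]
      | some i => rw [ha1 x]; cases p <;> simp [b])
    (by
      intro x y o p hop
      cases o with
      | none =>
        cases p with
        | none => exact absurd rfl hop
        | some i => rw [ha0 x, hb0 x]; simp [a, b]
      | some i =>
        cases p with
        | none => rw [ha1 x, hb1 x]; simp [a, b]
        | some k =>
          have : i ≠ k := fun h => hop (by rw [h])
          rw [ha1 x, hb1 x]; simp [a, b, this])
    (by
      intro x y o
      cases o with
      | none => rw [ha0 x, hb0 x]; simp [a, b, mul_comm]
      | some i => rw [ha1 x, hb1 x]; simp [a, b, mul_comm])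
    (by
      intro x
      have := hD x.1 x.2
      simp only [← pow_two, this, sub_self])
    (by
      intro x y
      have h1 := hD x.1 x.2
      have h2 := hD y.1 y.2
      have h3 := Real.sum_mul_le_sqrt_mul_sqrt Finset.univ x.1 y.1
      rw [h1, h2] at h3
      simp at h3
      linarith)
    f f' C hfc hfc' hf0 hf1 hC hf hs
  set E : Set (Fin m → Fin n → ℝ) := {A | ∃ x ∈ D, ∑ i, (∑ j, A i j * x j) ^ 2 < 1} with hE
  have hEm : MeasurableSet E := by
    have : E = ⋃ x ∈ D, {A | ∑ i, (∑ j, A i j * x j) ^ 2 < 1} := by ext; simp [hE]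
    rw [this]
    refine Finset.measurableSet_biUnion _ fun x _ => ?_
    exact measurableSet_lt (by fun_prop) measurable_const
  let EX : Set (ι → ℝ) := {ξ | (fun i j => ξ (.inl ⟨i, j⟩)) ∈ E ∧ ξ (.inr (.inl ())) ≤ -3}
  let EY : Set (ι → ℝ) := {ξ | (fun i => ξ (.inr (.inr (.inl i)))) ∈ Hb} ∪
    {ξ | (fun j => ξ (.inr (.inr (.inr j)))) ∈ Gb}
  have hm1 : MeasurableSet {ξ : ι → ℝ | (fun i => ξ (.inr (.inr (.inl i)))) ∈ Hb} :=
    (by fun_prop : Measurable fun (ξ : ι → ℝ) (i : Fin m) => ξ (.inr (.inr (.inl i)))) hHb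
  have hm2 : MeasurableSet {ξ : ι → ℝ | (fun j => ξ (.inr (.inr (.inr j)))) ∈ Gb} :=
    (by fun_prop : Measurable fun (ξ : ι → ℝ) (j : Fin n) => ξ (.inr (.inr (.inr j)))) hGb
  have hEY : MeasurableSet EY := hm1.union hm2
  have hEX : MeasurableSet EX := by
    refine MeasurableSet.inter ?_ ?_
    · exact (by fun_prop : Measurable fun (ξ : ι → ℝ) (i : Fin m) (j : Fin n) => ξ (.inl ⟨i, j⟩)) hEm
    · exact measurableSet_le (measurable_pi_apply _) measurable_const
  have hfp : ∀ (w : D → Option (Fin m) → ℝ), 0 ≤ ∏ y, f (w y) ∧ ∏ y, f (w y) ≤ 1 := by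
    intro w
    exact ⟨Finset.prod_nonneg fun y _ => hf0 _, Finset.prod_le_one (fun y _ => hf0 _) fun y _ => hf1 _⟩
  have hdot : ∀ v : ι → ℝ, Continuous (fun ξ : ι → ℝ => v ⬝ᵥ ξ) := by
    intro v; unfold dotProduct; fun_prop
  have hint : ∀ c : D → Option (Fin m) → ι → ℝ,
      Integrable (fun ξ => ∏ x, f (fun o => c x o ⬝ᵥ ξ)) γ := by
    intro c
    refine Integrable.of_bound (C := 1) ?_ (Filter.Eventually.of_forall fun ξ => ?_)
    · refine Continuous.aestronglyMeasurable ?_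
      exact continuous_finsetProd _ fun x _ => hfc.comp (continuous_pi fun o => hdot _)
    · rw [Real.norm_eq_abs, abs_of_nonneg (hfp _).1]; exact (hfp _).2
  have hX : ∫ ξ, ∏ x, f (fun o => a x o ⬝ᵥ ξ) ∂γ ≤ γ.real EXᶜ := by
    rw [← integral_indicator_one hEX.compl]
    refine integral_mono (hint a) ((integrable_const (1:ℝ)).indicator hEX.compl) fun ξ => ?_
    by_cases h : ξ ∈ EX
    · rw [Set.indicator_of_notMem (by simpa using h)]
      obtain ⟨⟨x, hx, hx1⟩, h2⟩ := h
      refine le_of_eq (Finset.prod_eq_zero (Finset.mem_univ ⟨x, hx⟩) (hfz _ ?_ ?_))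
      · simpa only [ha1] using hx1
      · rw [ha0 ⟨x, hx⟩]; exact h2
    · rw [Set.indicator_of_mem (by simpa using h)]
      exact (hfp _).2
  have hY : γ.real EYᶜ ≤ ∫ ξ, ∏ x, f (fun o => b x o ⬝ᵥ ξ) ∂γ := by
    rw [← integral_indicator_one hEY.compl]
    refine integral_mono ((integrable_const (1:ℝ)).indicator hEY.compl) (hint b) fun ξ => ?_
    by_cases h : ξ ∈ EY
    · rw [Set.indicator_of_notMem (by simpa using h)]
      exact (hfp _).1
    · rw [Set.indicator_of_mem (by simpa using h)]
      refine le_of_eq (Finset.prod_eq_one fun x _ => hfo _ ?_).symm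
      have h' : ¬ _ ∧ ¬ _ := not_or.mp h
      have := hgood _ h'.1 _ h'.2 x.1 x.2
      simpa only [hb0, hb1] using this
  have hle : γ EX ≤ γ EY := by
    have h1 : γ.real EYᶜ ≤ γ.real EXᶜ := hY.trans (main.trans hX)
    rw [probReal_compl_eq_one_sub hEX, probReal_compl_eq_one_sub hEY] at h1
    have h2 : γ.real EX ≤ γ.real EY := by linarith
    rwa [Measure.real, Measure.real, ENNReal.toReal_le_toReal (measure_ne_top _ _) (measure_ne_top _ _)] at h2
  have hEYle : γ EY ≤ (Measure.pi fun _ => gaussianReal 0 1) Hb + (Measure.pi fun _ => gaussianReal 0 1) Gb := by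
    refine (measure_union_le _ _).trans (le_of_eq ?_)
    congr 1
    · exact (pi_marginal (ι := ι) (fun i : Fin m => .inr (.inr (.inl i)))
        (fun i j h => Sum.inl_injective (Sum.inr_injective (Sum.inr_injective h)))).measure_preimage hHb.nullMeasurableSet
    · exact (pi_marginal (ι := ι) (fun i : Fin n => .inr (.inr (.inr i)))
        (fun i j h => Sum.inr_injective (Sum.inr_injective (Sum.inr_injective h)))).measure_preimage hGb.nullMeasurableSet
  have hEXeq : γ EX = gaussianReal 0 1 (Set.Iic (-3)) * matrixGaussian m n E := by
    have mp := measurePreserving_sumPiEquivProdPi (ι := Σ _ : Fin m, Fin n)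
      (ι' := Unit ⊕ (Fin m ⊕ Fin n)) (X := fun _ => ℝ) (fun _ => gaussianReal 0 1)
    let E1 : Set ((Σ _ : Fin m, Fin n) → ℝ) := {ξ | (fun i j => ξ ⟨i, j⟩) ∈ E}
    let E2 : Set ((Unit ⊕ (Fin m ⊕ Fin n)) → ℝ) := {ξ | ξ (.inl ()) ∈ Set.Iic (-3)}
    have e1 : (Measure.pi fun _ => gaussianReal 0 1) E1 = matrixGaussian m n E :=
      (matrix_curry m n).measure_preimage hEm.nullMeasurableSet
    have e2 : (Measure.pi fun _ => gaussianReal 0 1) E2 = gaussianReal 0 1 (Set.Iic (-3)) :=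
      (measurePreserving_eval (fun _ : Unit ⊕ (Fin m ⊕ Fin n) => gaussianReal 0 1)
        (.inl ())).measure_preimage measurableSet_Iic.nullMeasurableSet
    have mE1 : MeasurableSet E1 := (matrix_curry m n).measurable hEm
    have mE2 : MeasurableSet E2 := (measurable_pi_apply _) measurableSet_Iic
    have := mp.measure_preimage (mE1.prod mE2).nullMeasurableSet
    rw [Measure.prod_prod, e1, e2, mul_comm] at this
    rw [← this]
    rfl
  rw [← hEXeq]
  exact hle.trans hEYle

lemma escape (m n : ℕ) (S : Set (Fin n → ℝ)) (hS : ∀ x ∈ S, ∑ j, x j ^ 2 = 1)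
    (Hb : Set (Fin m → ℝ)) (Gb : Set (Fin n → ℝ)) (hHb : MeasurableSet Hb) (hGb : MeasurableSet Gb)
    (hgood : ∀ h ∉ Hb, ∀ g ∉ Gb, ∀ x ∈ S, 1 ≤ √(∑ i, h i ^ 2) + ∑ j, g j * x j) :
    gaussianReal 0 1 (Set.Iic (-3)) *
      matrixGaussian m n {A | ∃ x ∈ S, ∀ i, ∑ j, A i j * x j = 0} ≤
    (Measure.pi fun _ => gaussianReal 0 1) Hb + (Measure.pi fun _ => gaussianReal 0 1) Gb := by
  classical
  rcases S.eq_empty_or_nonempty with rfl | hne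
  · simp
  obtain ⟨t, htS, htc, hcl⟩ := (TopologicalSpace.IsSeparable.of_separableSpace S).exists_countable_dense_subset
  have htne : t.Nonempty := by
    rw [← closure_nonempty_iff]; exact hne.mono hcl
  obtain ⟨u, hu⟩ := htc.exists_eq_range htne
  let Ej : ℕ → Set (Fin m → Fin n → ℝ) := fun k =>
    {A | ∃ x ∈ (Finset.range k).image u, ∑ i, (∑ j, A i j * x j) ^ 2 < 1}
  have hmono : Monotone Ej := by
    intro k l hkl A hA
    obtain ⟨x, hx, h⟩ := hA
    exact ⟨x, Finset.image_subset_image (Finset.range_mono hkl) hx, h⟩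
  have hsub : {A : Fin m → Fin n → ℝ | ∃ x ∈ S, ∀ i, ∑ j, A i j * x j = 0} ⊆ ⋃ k, Ej k := by
    rintro A ⟨x, hx, hA⟩
    have hopen : IsOpen {y : Fin n → ℝ | ∑ i, (∑ j, A i j * y j) ^ 2 < 1} :=
      isOpen_lt (by fun_prop) continuous_const
    obtain ⟨y, hy, hyt⟩ := mem_closure_iff.1 (hcl hx) _ hopen (by simp [hA])
    rw [hu] at hyt
    obtain ⟨k, rfl⟩ := hyt
    refine Set.mem_iUnion.2 ⟨k + 1, u k, ?_, hy⟩
    exact Finset.mem_image_of_mem _ (Finset.self_mem_range_succ k)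
  calc _ ≤ gaussianReal 0 1 (Set.Iic (-3)) * matrixGaussian m n (⋃ k, Ej k) := by gcongr
    _ = ⨆ k, gaussianReal 0 1 (Set.Iic (-3)) * matrixGaussian m n (Ej k) := by
      rw [hmono.measure_iUnion, ENNReal.mul_iSup]
    _ ≤ _ := by
      refine iSup_le fun k => ?_
      have hS' : ∀ x ∈ (Finset.range k).image u, x ∈ S := by
        intro x hx
        obtain ⟨l, _, rfl⟩ := Finset.mem_image.1 hx
        exact htS (hu ▸ Set.mem_range_self l)
      exact gordon_finite m n _ (fun x hx => hS x (hS' x hx)) Hb Gb hHb hGb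
        (fun h hh g hg x hx => hgood h hh g hg x (hS' x hx))

lemma integrable_exp_quarter : Integrable (fun x : ℝ => Real.exp ((1 + x ^ 2) / 4)) (gaussianReal 0 1) := by
  rw [gaussianReal_of_var_ne_zero _ one_ne_zero,
    integrable_withDensity_iff_integrable_smul' (measurable_gaussianPDF 0 1)
      (Filter.Eventually.of_forall fun x => gaussianPDF_lt_top)]
  have h := (integrable_exp_neg_mul_sq (b := 1/4) (by norm_num)).const_mul
    ((√(2 * Real.pi))⁻¹ * Real.exp (1/4))
  refine h.congr (Filter.Eventually.of_forall fun x => ?_)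
  simp only [toReal_gaussianPDF, gaussianPDFReal, smul_eq_mul]
  have e1 : Real.exp (-(1/4) * x ^ 2) = Real.exp (-(1/2) * x^2) * Real.exp (x^2/4) := by
    rw [← Real.exp_add]; congr 1; ring
  have e2 : Real.exp ((1 + x^2)/4) = Real.exp (1/4) * Real.exp (x^2/4) := by
    rw [← Real.exp_add]; congr 1; ring
  have e3 : Real.exp (-(x - 0)^2 / (2 * ((1:NNReal):ℝ))) = Real.exp (-(1/2) * x^2) := by
    congr 1; simp; ring
  rw [e1, e2, e3]
  simp
  ring

lemma integrable_exp_of_growth (Y : ℝ → ℝ) (hY : Measurable Y) (C : ℝ) (hC : 0 < C)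
    (hb : ∀ x, |Y x| ≤ C * (1 + x ^ 2)) :
    0 ∈ interior (integrableExpSet Y (gaussianReal 0 1)) := by
  rw [mem_interior_iff_mem_nhds, Metric.mem_nhds_iff]
  refine ⟨1 / (4 * C), by positivity, fun l hl => ?_⟩
  rw [Metric.mem_ball, Real.dist_eq, sub_zero] at hl
  change Integrable (fun x => Real.exp (l * Y x)) _
  refine integrable_exp_quarter.mono (by fun_prop) (Filter.Eventually.of_forall fun x => ?_)
  rw [Real.norm_eq_abs, Real.norm_eq_abs, Real.abs_exp, Real.abs_exp, Real.exp_le_exp]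
  have h1 : l * Y x ≤ |l| * |Y x| := by rw [← abs_mul]; exact le_abs_self _
  have h2 : |l| * |Y x| ≤ 1 / (4 * C) * (C * (1 + x^2)) :=
    mul_le_mul hl.le (hb x) (abs_nonneg _) (by positivity)
  have h3 : 1 / (4 * C) * (C * (1 + x^2)) = (1 + x^2)/4 := by field_simp
  linarith

lemma chernoff (Y : ℝ → ℝ) (hY : Measurable Y) (C : ℝ) (hC : 0 < C)
    (hb : ∀ x, |Y x| ≤ C * (1 + x ^ 2)) (c : ℝ) (hc : ∫ x, Y x ∂(gaussianReal 0 1) < c) :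
    ∃ ε > 0, ∀ N : ℕ, (Measure.pi fun _ : Fin N => gaussianReal 0 1)
      {ξ | c * N ≤ ∑ i, Y (ξ i)} ≤ ENNReal.ofReal (Real.exp (-ε * N)) := by
  have h0 := integrable_exp_of_growth Y hY C hC hb
  have hd : HasDerivAt (fun l => Real.exp (-l * c) * mgf Y (gaussianReal 0 1) l)
      (∫ x, Y x ∂(gaussianReal 0 1) - c) 0 := by
    have h1 := hasDerivAt_mgf h0
    have h2 : HasDerivAt (fun l : ℝ => Real.exp (-l * c)) (Real.exp (-0 * c) * (-1 * c)) 0 :=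
      ((hasDerivAt_id (0:ℝ)).neg.mul_const c).exp
    convert! h2.mul h1 using 1
    simp
    ring
  have hev : ∀ᶠ l in nhdsWithin (0:ℝ) (Set.Ioi 0),
      Real.exp (-l * c) * mgf Y (gaussianReal 0 1) l < 1 := by
    have h1 := (hasDerivAt_iff_tendsto_slope.1 hd).mono_left
      (nhdsWithin_mono 0 (fun x (hx : x ∈ Set.Ioi (0:ℝ)) => (Set.mem_Ioi.1 hx).ne'))
    have h2 := h1.eventually (gt_mem_nhds (sub_neg.2 hc))
    filter_upwards [h2, self_mem_nhdsWithin] with l hl hl0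
    rw [slope_def_field] at hl
    have h3 : 0 < l := hl0
    rw [div_lt_iff₀ (by linarith)] at hl
    simp at hl
    simpa using hl
  have hev2 : ∀ᶠ l in nhdsWithin (0:ℝ) (Set.Ioi 0), l ∈ integrableExpSet Y (gaussianReal 0 1) :=
    nhdsWithin_le_nhds (mem_interior_iff_mem_nhds.1 h0)
  obtain ⟨l, ⟨hl1, hl2⟩, hl0⟩ := ((hev.and hev2).and self_mem_nhdsWithin).exists
  have hl0 : 0 < l := hl0
  have hl2 : Integrable (fun x => Real.exp (l * Y x)) (gaussianReal 0 1) := hl2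
  set q := Real.exp (-l * c) * mgf Y (gaussianReal 0 1) l with hq
  have hq0 : 0 < q := mul_pos (Real.exp_pos _) (mgf_pos hl2)
  refine ⟨-Real.log q, by linarith [Real.log_neg hq0 hl1], fun N => ?_⟩
  have hind : iIndepFun (fun (i : Fin N) (ω : Fin N → ℝ) => Y (ω i))
      (Measure.pi fun _ : Fin N => gaussianReal 0 1) :=
    iIndepFun_pi (X := fun _ x => Y x) fun i => hY.aemeasurable
  have hm : ∀ i : Fin N, Measurable (fun (ω : Fin N → ℝ) => Y (ω i)) := fun i => by fun_prop
  have hmp := fun i : Fin N => measurePreserving_eval (fun _ : Fin N => gaussianReal 0 1) i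
  have hint : ∀ i ∈ (Finset.univ : Finset (Fin N)), Integrable (fun ω : Fin N → ℝ => Real.exp (l * Y (ω i)))
      (Measure.pi fun _ : Fin N => gaussianReal 0 1) := fun i _ =>
    (hmp i).integrable_comp_of_integrable hl2
  have h1 := measure_ge_le_exp_mul_mgf (c * N) hl0.le (hind.integrable_exp_mul_sum hm hint)
  have h2 : mgf (∑ i, fun (ω : Fin N → ℝ) => Y (ω i)) (Measure.pi fun _ : Fin N => gaussianReal 0 1) l
      = mgf Y (gaussianReal 0 1) l ^ N := by
    rw [hind.mgf_sum hm]
    rw [Finset.prod_eq_pow_card (b := mgf Y (gaussianReal 0 1) l)]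
    · simp
    · intro i _
      have := (hmp i).map_eq
      conv_rhs => rw [← this]
      rw [mgf_map (hmp i).measurable.aemeasurable (by
        exact (by fun_prop : Measurable fun x => Real.exp (l * Y x)).aestronglyMeasurable)]
      rfl
  rw [h2] at h1
  have h3 : Real.exp (-l * (c * N)) * mgf Y (gaussianReal 0 1) l ^ N = Real.exp (-(-Real.log q) * N) := by
    have : Real.exp (-(-Real.log q) * N) = q ^ N := by
      rw [neg_neg, mul_comm, Real.exp_nat_mul, Real.exp_log hq0]
    rw [this, hq, mul_pow, ← Real.exp_nat_mul]
    congr 2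
    ring
  rw [h3] at h1
  rw [ENNReal.le_ofReal_iff_toReal_le (measure_ne_top _ _) (Real.exp_pos _).le]
  simpa [Measure.real, Finset.sum_apply] using h1

noncomputable def phi (x : ℝ) : ℝ := (√(2 * Real.pi))⁻¹ * Real.exp (-x ^ 2 / 2)

noncomputable def qtail (a : ℝ) : ℝ := ∫ x in Set.Ioi a, phi x

lemma phi_eq (x : ℝ) : gaussianPDFReal 0 1 x = phi x := by
  simp [gaussianPDFReal, phi]

lemma phi_pos (x : ℝ) : 0 < phi x := by unfold phi; positivity

lemma phi_continuous : Continuous phi := by unfold phi; fun_prop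

lemma phi_hasDerivAt (x : ℝ) : HasDerivAt phi (-(x * phi x)) x := by
  have h : HasDerivAt (fun x : ℝ => -x ^ 2 / 2) (-x) x := by
    have := ((hasDerivAt_id x).fun_pow 2).neg.div_const 2
    convert! this using 1
    simp
    ring
  have := h.exp.const_mul ((√(2 * Real.pi))⁻¹)
  convert! this using 1
  unfold phi
  ring

lemma phi_integrable : Integrable phi := by
  have := integrable_gaussianPDFReal 0 1
  exact this.congr (Filter.Eventually.of_forall phi_eq)

lemma phi_mul_integrable (f : ℝ → ℝ) (hf : Integrable f (gaussianReal 0 1)) :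
    Integrable (fun x => f x * phi x) := by
  rw [gaussianReal_of_var_ne_zero _ one_ne_zero,
    integrable_withDensity_iff_integrable_smul' (measurable_gaussianPDF 0 1)
      (Filter.Eventually.of_forall fun x => gaussianPDF_lt_top)] at hf
  refine hf.congr (Filter.Eventually.of_forall fun x => ?_)
  simp only [toReal_gaussianPDF, phi_eq, smul_eq_mul, mul_comm]

lemma integrable_x : Integrable (fun x : ℝ => x) (gaussianReal 0 1) :=
  (memLp_id_gaussianReal 1).integrable (by simp)

lemma integrable_x2 : Integrable (fun x : ℝ => x ^ 2) (gaussianReal 0 1) :=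
  (memLp_id_gaussianReal 2).integrable_sq

lemma int_x_phi (a : ℝ) : ∫ x in Set.Ioi a, x * phi x = phi a := by
  have h := integral_Ioi_of_hasDerivAt_of_tendsto' (f := fun x => -phi x) (f' := fun x => x * phi x) (a := a)
    (m := 0) (fun x _ => by simpa using (phi_hasDerivAt x).fun_neg)
    (phi_mul_integrable _ integrable_x).integrableOn
    (tendsto_zero_of_hasDerivAt_of_integrableOn_Ioi (a := a)
      (fun x _ => by simpa using (phi_hasDerivAt x).fun_neg)
      (phi_mul_integrable _ integrable_x).integrableOn phi_integrable.neg.integrableOn)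
  rw [h]; ring

lemma int_lin (a : ℝ) : ∫ x in Set.Ioi a, (x - a) * phi x = phi a - a * qtail a := by
  have : ∀ x, (x - a) * phi x = x * phi x - a * phi x := fun x => by ring
  simp_rw [this]
  rw [integral_sub (phi_mul_integrable _ integrable_x).integrableOn
    (phi_integrable.const_mul a).integrableOn, int_x_phi, integral_const_mul, qtail]

lemma int_sq (a : ℝ) : ∫ x in Set.Ioi a, (x - a) ^ 2 * phi x = (1 + a ^ 2) * qtail a - a * phi a := by
  have hd : ∀ x, HasDerivAt (fun x => -((x - 2 * a) * phi x)) (((x - a) ^ 2 - (1 + a ^ 2)) * phi x) x := by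
    intro x
    have := ((((hasDerivAt_id x).sub_const (2 * a))).mul (phi_hasDerivAt x)).neg
    convert! this using 1
    simp
    ring
  have hi2 : Integrable (fun x => (x - a) ^ 2 * phi x) := by
    apply phi_mul_integrable
    have : ∀ x : ℝ, (x - a) ^ 2 = x ^ 2 - 2 * a * x + a ^ 2 := fun x => by ring
    simp_rw [this]
    exact (integrable_x2.sub (integrable_x.const_mul _)).add (integrable_const _)
  have hi1 : Integrable (fun x => ((x - a) ^ 2 - (1 + a ^ 2)) * phi x) := by
    refine (hi2.sub (phi_integrable.const_mul (1 + a ^ 2))).congr (Filter.Eventually.of_forall fun x => ?_)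
    simp; ring
  have hi0 : Integrable (fun x => -((x - 2 * a) * phi x)) := by
    refine Integrable.neg (phi_mul_integrable _ ?_)
    exact integrable_x.sub (integrable_const _)
  have h := integral_Ioi_of_hasDerivAt_of_tendsto' (a := a) (m := 0) (fun x _ => hd x) hi1.integrableOn
    (tendsto_zero_of_hasDerivAt_of_integrableOn_Ioi (a := a) (fun x _ => hd x) hi1.integrableOn hi0.integrableOn)
  have e : ∀ x, ((x - a) ^ 2 - (1 + a ^ 2)) * phi x = (x - a) ^ 2 * phi x - (1 + a ^ 2) * phi x :=
    fun x => by ring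
  simp_rw [e] at h
  rw [integral_sub hi2.integrableOn (phi_integrable.const_mul _).integrableOn, integral_const_mul] at h
  unfold qtail
  linarith

lemma gauss_abs (f : ℝ → ℝ) : ∫ x, f |x| ∂(gaussianReal 0 1) = 2 * ∫ x in Set.Ioi (0:ℝ), f x * phi x := by
  rw [integral_gaussianReal_eq_integral_smul one_ne_zero, ← integral_comp_abs (f := fun x => f x * phi x)]
  congr 1
  ext x
  rw [phi_eq, smul_eq_mul, mul_comm]
  simp [phi]

lemma gauss_pos_part (f : ℝ → ℝ) (a : ℝ) (ha : 0 ≤ a) (hf : f 0 = 0) :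
    ∫ x, f (max (|x| - a) 0) ∂(gaussianReal 0 1) = 2 * ∫ x in Set.Ioi a, f (x - a) * phi x := by
  rw [gauss_abs (fun y => f (max (y - a) 0))]
  congr 1
  rw [← integral_indicator measurableSet_Ioi, ← integral_indicator measurableSet_Ioi]
  congr 1
  ext x
  simp only [Set.indicator_apply, Set.mem_Ioi]
  by_cases h : a < x
  · rw [if_pos h, if_pos (lt_of_le_of_lt ha h), max_eq_left (by linarith)]
  · rw [if_neg h]
    by_cases h2 : 0 < x
    · rw [if_pos h2, max_eq_right (by linarith), hf, zero_mul]
    · rw [if_neg h2]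

noncomputable def Yf (ν t x : ℝ) : ℝ := (max (|x| - ν) 0) ^ 2 + 4 * ν * max (|x| - t) 0

lemma Yf_growth (ν t : ℝ) (hν : 0 ≤ ν) (ht : 0 ≤ t) (x : ℝ) :
    0 ≤ Yf ν t x ∧ Yf ν t x ≤ (1 + 4 * ν) * (1 + x ^ 2) := by
  unfold Yf
  have h0 : 0 ≤ max (|x| - ν) 0 := le_max_right _ _
  have h1 : max (|x| - ν) 0 ≤ |x| := max_le (by linarith) (abs_nonneg _)
  have h2 : max (|x| - t) 0 ≤ |x| := max_le (by linarith) (abs_nonneg _)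
  have h3 : 0 ≤ max (|x| - t) 0 := le_max_right _ _
  refine ⟨by positivity, ?_⟩
  have h4 : (max (|x| - ν) 0) ^ 2 ≤ x ^ 2 := by rw [← sq_abs x]; gcongr
  have h5 : |x| ≤ 1 + x ^ 2 := by rw [← sq_abs x]; nlinarith [sq_nonneg (|x| - 1)]
  have h6 : 4 * ν * max (|x| - t) 0 ≤ 4 * ν * (1 + x ^ 2) := by gcongr; linarith
  linarith

lemma Yf_meas (ν t : ℝ) : Measurable (Yf ν t) := by
  unfold Yf; fun_prop

lemma Yf_integral (ν t : ℝ) (hν : 0 ≤ ν) (ht : 0 ≤ t) :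
    ∫ x, Yf ν t x ∂(gaussianReal 0 1) =
      2 * ((1 + ν ^ 2) * qtail ν - ν * phi ν) + 4 * ν * (2 * (phi t - t * qtail t)) := by
  have hx : Integrable (fun x : ℝ => |x|) (gaussianReal 0 1) := integrable_x.abs
  unfold Yf
  rw [integral_add, integral_const_mul]
  · rw [gauss_pos_part (fun y => y ^ 2) ν hν (by simp), gauss_pos_part (fun y => y) t ht rfl, int_sq, int_lin]
  · refine integrable_x2.mono (by fun_prop) (Filter.Eventually.of_forall fun x => ?_)
    rw [Real.norm_eq_abs, Real.norm_eq_abs, abs_of_nonneg (sq_nonneg (max (|x| - ν) 0)), abs_of_nonneg (sq_nonneg x), ← sq_abs x]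
    have h0 : 0 ≤ max (|x| - ν) 0 := le_max_right _ _
    have h1 : max (|x| - ν) 0 ≤ |x| := max_le (by linarith) (abs_nonneg _)
    gcongr
  · refine Integrable.const_mul ?_ _
    refine hx.mono (by fun_prop) (Filter.Eventually.of_forall fun x => ?_)
    have h3 : 0 ≤ max (|x| - t) 0 := le_max_right _ _
    rw [Real.norm_eq_abs, Real.norm_eq_abs, abs_of_nonneg h3, abs_abs]
    exact max_le (by linarith) (abs_nonneg _)

lemma qtail_nonneg (a : ℝ) : 0 ≤ qtail a := integral_nonneg fun x => (phi_pos x).le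

lemma qtail_zero : qtail 0 = 1 / 2 := by
  have h := gauss_abs (fun _ => 1)
  simp at h
  unfold qtail
  linarith

lemma qtail_eq (a : ℝ) : qtail a = 1 / 2 - ∫ x in (0:ℝ)..a, phi x := by
  have := intervalIntegral.integral_interval_add_Ioi (a := 0) (b := a) phi_integrable.integrableOn
    phi_integrable.integrableOn
  have h0 := qtail_zero
  unfold qtail at *
  linarith

lemma erfc_eq (a : ℝ) : erfc (a / √2) = 2 * qtail a := by
  have h2 : √2 ≠ 0 := by positivity
  have e := intervalIntegral.integral_comp_div (a := 0) (b := a) (fun s => Real.exp (-s ^ 2)) h2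
  rw [qtail_eq, erfc, erf]
  have : ∀ x : ℝ, Real.exp (-(x / √2) ^ 2) = √(2 * Real.pi) * phi x := by
    intro x
    unfold phi
    rw [← mul_assoc, mul_inv_cancel₀ (by positivity), one_mul, div_pow, Real.sq_sqrt (by norm_num)]
    ring_nf
  simp_rw [this] at e
  rw [intervalIntegral.integral_const_mul, zero_div, smul_eq_mul, Real.sqrt_mul (by norm_num)] at e
  have hp : √Real.pi ≠ 0 := by positivity
  have e2 : ∫ t in (0:ℝ)..(a / √2), Real.exp (-t ^ 2) = √Real.pi * ∫ x in (0:ℝ)..a, phi x := by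
    apply mul_left_cancel₀ h2
    rw [← e]; ring
  rw [e2]
  field_simp

lemma qtail_hasDerivAt (a : ℝ) : HasDerivAt qtail (-phi a) a := by
  have h : HasDerivAt (fun a => ∫ x in (0:ℝ)..a, phi x) (phi a) a :=
    intervalIntegral.integral_hasDerivAt_right (phi_continuous.intervalIntegrable _ _)
      (phi_continuous.stronglyMeasurableAtFilter _ _) phi_continuous.continuousAt
  have := h.const_sub (1 / 2)
  exact this.congr_of_eventuallyEq (Filter.Eventually.of_forall qtail_eq)

lemma qtail_tendsto : Filter.Tendsto qtail Filter.atTop (nhds 0) := by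
  have h := intervalIntegral_tendsto_integral_Ioi 0 (phi_integrable.integrableOn) Filter.tendsto_id
  have h2 := h.const_sub (1/2)
  have h0 := qtail_zero
  unfold qtail at h0
  rw [h0, sub_self] at h2
  exact h2.congr fun a => (qtail_eq a).symm

lemma exists_erf (y : ℝ) (hy : y ∈ Set.Ioo (0:ℝ) 1) : ∃ x, erf x = y := by
  have hc : Continuous qtail := continuous_iff_continuousAt.2 fun x => (qtail_hasDerivAt x).continuousAt
  obtain ⟨b, hb, hb0⟩ := ((qtail_tendsto.eventually (gt_mem_nhds (show (0:ℝ) < (1 - y) / 2 by linarith [hy.2]))).and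
    (Filter.eventually_ge_atTop 0)).exists
  have := intermediate_value_Icc' hb0 hc.continuousOn
  have h0 := qtail_zero
  obtain ⟨x, -, hx⟩ := this ⟨hb.le, show (1 - y) / 2 ≤ qtail 0 by linarith [hy.1]⟩
  refine ⟨x / √2, ?_⟩
  have := erfc_eq x
  rw [erfc] at this
  linarith

lemma erfinv_spec (β : ℝ) (hβ : β ∈ Set.Ioo (0:ℝ) 1) :
    0 < √2 * erfinv (1 - β) ∧ 2 * qtail (√2 * erfinv (1 - β)) = β := by
  have h1 : erf (erfinv (1 - β)) = 1 - β :=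
    Function.invFun_eq (exists_erf (1 - β) ⟨by linarith [hβ.2], by linarith [hβ.1]⟩)
  have h2 : √2 ≠ 0 := by positivity
  have h3 := erfc_eq (√2 * erfinv (1 - β))
  rw [mul_div_cancel_left₀ _ h2, erfc, h1] at h3
  have h4 : 2 * qtail (√2 * erfinv (1 - β)) = β := by linarith
  refine ⟨?_, h4⟩
  by_contra hneg
  rw [not_lt] at hneg
  have : qtail 0 ≤ qtail (√2 * erfinv (1 - β)) :=
    setIntegral_mono_set phi_integrable.integrableOn (Filter.Eventually.of_forall fun x => (phi_pos x).le)
      (Set.Ioi_subset_Ioi hneg).eventuallyLE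
  rw [qtail_zero] at this
  linarith [hβ.2]

noncomputable def Ff (t ν : ℝ) : ℝ := 2 * ((1 + ν ^ 2) * qtail ν - ν * phi ν) + 8 * ν * phi t

lemma Ff_mono (t : ℝ) (ht : 0 ≤ t) : MonotoneOn (Ff t) (Set.Ici t) := by
  have hd : ∀ x, HasDerivAt (Ff t) (4 * x * qtail x - 4 * phi x + 8 * phi t) x := by
    intro x
    have h1 : HasDerivAt (fun x : ℝ => 1 + x ^ 2) (2 * x) x := by
      simpa using ((hasDerivAt_id x).fun_pow 2).const_add 1
    have h2 := (((h1.mul (qtail_hasDerivAt x)).sub ((hasDerivAt_id x).mul (phi_hasDerivAt x))).const_mul 2).add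
      (((hasDerivAt_id x).const_mul 8).mul_const (phi t))
    convert! h2 using 1
    simp
    ring
  refine monotoneOn_of_deriv_nonneg (convex_Ici t)
    (fun x _ => (hd x).continuousAt.continuousWithinAt)
    (fun x _ => (hd x).differentiableAt.differentiableWithinAt) ?_
  intro x hx
  rw [interior_Ici] at hx
  rw [(hd x).deriv]
  have hx : t < x := hx
  have h1 : phi x ≤ phi t := by
    unfold phi
    gcongr
  have h2 := phi_pos t
  have h3 : 0 ≤ x * qtail x := mul_nonneg (by linarith) (qtail_nonneg x)
  linarith

lemma cond_reduce (α β : ℝ) (hα : α ∈ Set.Ioo (0 : ℝ) 1) (hβ : β ∈ Set.Ioo (0 : ℝ) 1)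
    (hcond : sInf {v : ℝ | ∃ ν : ℝ, 0 ≤ ν ∧
        v = Real.sqrt ((1 + ν ^ 2) * erfc (ν / Real.sqrt 2) +
          (4 * ν / Real.sqrt (2 * Real.pi)) *
            (2 * Real.exp (-(erfinv (1 - β)) ^ 2) - (1 / 2) * Real.exp (-ν ^ 2 / 2)))}
      < Real.sqrt α) :
    ∃ ν t : ℝ, 0 ≤ ν ∧ ν ≤ t ∧ ∫ x, Yf ν t x ∂(gaussianReal 0 1) + 4 * ν * t * β < α := by
  obtain ⟨v, ⟨ν, hν, rfl⟩, hv⟩ := exists_lt_of_csInf_lt (by exact ⟨_, 0, le_rfl, rfl⟩) hcond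
  have hv := (Real.sqrt_lt_sqrt_iff_of_pos hα.1).1 hv
  obtain ⟨ht, htβ⟩ := erfinv_spec β hβ
  set t := √2 * erfinv (1 - β) with htdef
  have hF : (1 + ν ^ 2) * erfc (ν / Real.sqrt 2) +
          (4 * ν / Real.sqrt (2 * Real.pi)) *
            (2 * Real.exp (-(erfinv (1 - β)) ^ 2) - (1 / 2) * Real.exp (-ν ^ 2 / 2)) = Ff t ν := by
    rw [erfc_eq, Ff]
    have : Real.exp (-(erfinv (1 - β)) ^ 2) = √(2 * Real.pi) * phi t := by
      unfold phi
      rw [← mul_assoc, mul_inv_cancel₀ (by positivity), one_mul, htdef, mul_pow, Real.sq_sqrt (by norm_num)]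
      ring_nf
    rw [this]
    have : Real.exp (-ν ^ 2 / 2) = √(2 * Real.pi) * phi ν := by
      unfold phi
      rw [← mul_assoc, mul_inv_cancel₀ (by positivity), one_mul]
    rw [this]
    have : √(2 * Real.pi) ≠ 0 := by positivity
    field_simp
    ring
  rw [hF] at hv
  have key : ∀ ν, 0 ≤ ν → ∫ x, Yf ν t x ∂(gaussianReal 0 1) + 4 * ν * t * β = Ff t ν := by
    intro ν hν
    rw [Yf_integral ν t hν ht.le, Ff, ← htβ]
    ring
  rcases le_total ν t with h | h
  · exact ⟨ν, t, hν, h, by rw [key ν hν]; exact hv⟩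
  · exact ⟨t, t, ht.le, le_rfl, by
      rw [key t ht.le]
      exact lt_of_le_of_lt (Ff_mono t ht.le (Set.self_mem_Ici) h h) hv⟩

lemma width_bound {n : ℕ} (ν t : ℝ) (hν : 0 ≤ ν) (hνt : ν ≤ t) (k : ℕ) (g w : Fin n → ℝ)
    (hw : ∑ j, w j ^ 2 = 1) (K : Finset (Fin n)) (hK : K.card ≤ k)
    (hKw : ∑ j ∈ Kᶜ, |w j| ≤ ∑ j ∈ K, |w j|) :
    -∑ j, g j * w j ≤ √(∑ j, Yf ν t (g j) + 4 * ν * t * k) := by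
  classical
  have ht : 0 ≤ t := hν.trans hνt
  let c : Fin n → ℝ := fun j => if j ∈ K then |g j| + ν else max (|g j| - ν) 0
  have h1 : -∑ j, g j * w j ≤ ∑ j, |g j| * |w j| := by
    rw [← Finset.sum_neg_distrib]
    refine Finset.sum_le_sum fun j _ => ?_
    rw [← abs_mul]; exact neg_le_abs _
  have h2 : ∑ j, |g j| * |w j| ≤ ∑ j, c j * |w j| := by
    have e1 := Finset.sum_add_sum_compl K (fun j => |g j| * |w j|)
    have e2 := Finset.sum_add_sum_compl K (fun j => c j * |w j|)
    have e3 : ∑ j ∈ K, c j * |w j| = ∑ j ∈ K, |g j| * |w j| + ν * ∑ j ∈ K, |w j| := by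
      rw [Finset.mul_sum, ← Finset.sum_add_distrib]
      refine Finset.sum_congr rfl fun j hj => ?_
      simp only [c, if_pos hj]; ring
    have e4 : ∑ j ∈ Kᶜ, |g j| * |w j| - ν * ∑ j ∈ Kᶜ, |w j| ≤ ∑ j ∈ Kᶜ, c j * |w j| := by
      rw [Finset.mul_sum, ← Finset.sum_sub_distrib]
      refine Finset.sum_le_sum fun j hj => ?_
      simp only [c, if_neg (Finset.mem_compl.1 hj)]
      have : |g j| - ν ≤ max (|g j| - ν) 0 := le_max_left _ _
      nlinarith [abs_nonneg (w j)]
    have := mul_le_mul_of_nonneg_left hKw hν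
    linarith
  have h3 := Real.sum_mul_le_sqrt_mul_sqrt Finset.univ c (fun j => |w j|)
  simp only [sq_abs, hw, Real.sqrt_one, mul_one] at h3
  refine h1.trans (h2.trans (h3.trans (Real.sqrt_le_sqrt ?_)))
  have h4 : ∀ j, c j ^ 2 ≤ Yf ν t (g j) + if j ∈ K then 4 * ν * t else 0 := by
    intro j
    simp only [c, Yf]
    have ha := abs_nonneg (g j)
    have hm : 0 ≤ max (|g j| - t) 0 := le_max_right _ _
    have hm2 : |g j| - t ≤ max (|g j| - t) 0 := le_max_left _ _
    split_ifs with h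
    · rcases le_total ν |g j| with h5 | h5
      · rw [max_eq_left (by linarith : (0:ℝ) ≤ |g j| - ν)]
        nlinarith
      · rw [max_eq_right (by linarith : |g j| - ν ≤ 0)]
        nlinarith [mul_nonneg hν hm, mul_nonneg hν (sub_nonneg.2 hνt)]
    · nlinarith [mul_nonneg hν hm]
  refine (Finset.sum_le_sum fun j _ => h4 j).trans ?_
  rw [Finset.sum_add_distrib, Finset.sum_ite_mem, Finset.univ_inter, Finset.sum_const, nsmul_eq_mul]
  have : (K.card : ℝ) ≤ k := by exact_mod_cast hK
  have h5 : 0 ≤ 4 * ν * t := by positivity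
  nlinarith

def badSet (n k : ℕ) : Set (Fin n → ℝ) :=
  {w | ∑ j, w j ^ 2 = 1 ∧ ∃ K : Finset (Fin n), K.card ≤ k ∧ ∑ j ∈ Kᶜ, |w j| ≤ ∑ j ∈ K, |w j|}

lemma fail_bad {m n : ℕ} (k : ℕ) (A : Fin m → Fin n → ℝ)
    (h : ¬ ∀ x : Fin n → ℝ, (∃ K : Finset (Fin n), K.card ≤ k ∧ ∀ i ∉ K, x i = 0) → UniqueL1Min A x) :
    ∃ w ∈ badSet n k, ∀ i, ∑ j, A i j * w j = 0 := by
  classical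
  unfold UniqueL1Min at h
  push Not at h
  obtain ⟨x, ⟨K, hK, hx⟩, z, hz, hne, hle⟩ := h
  let v : Fin n → ℝ := fun j => z j - x j
  have hv0 : 0 < ∑ j, v j ^ 2 := by
    obtain ⟨j, hj⟩ := Function.ne_iff.1 hne
    refine Finset.sum_pos' (fun j _ => sq_nonneg _) ⟨j, Finset.mem_univ _, ?_⟩
    have : v j ≠ 0 := sub_ne_zero.2 hj
    positivity
  have hvK : ∑ j ∈ Kᶜ, |v j| ≤ ∑ j ∈ K, |v j| := by
    have e1 := Finset.sum_add_sum_compl K (fun j => |z j|)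
    have e2 := Finset.sum_add_sum_compl K (fun j => |x j|)
    have e3 : ∑ j ∈ Kᶜ, |x j| = 0 := Finset.sum_eq_zero fun j hj => by
      rw [hx j (Finset.mem_compl.1 hj), abs_zero]
    have e4 : ∑ j ∈ Kᶜ, |v j| = ∑ j ∈ Kᶜ, |z j| := Finset.sum_congr rfl fun j hj => by
      simp only [v]; rw [hx j (Finset.mem_compl.1 hj), sub_zero]
    have e5 : ∑ j ∈ K, |x j| ≤ ∑ j ∈ K, |z j| + ∑ j ∈ K, |v j| := by
      rw [← Finset.sum_add_distrib]
      refine Finset.sum_le_sum fun j _ => ?_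
      have : x j = z j - v j := by simp [v]
      rw [this]; exact abs_sub _ _
    linarith
  set r := √(∑ j, v j ^ 2) with hr
  have hr0 : 0 < r := Real.sqrt_pos.2 hv0
  refine ⟨fun j => v j / r, ⟨?_, K, hK, ?_⟩, ?_⟩
  · simp only [div_pow]
    rw [← Finset.sum_div, hr, Real.sq_sqrt hv0.le, div_self hv0.ne']
  · simp only [abs_div]
    rw [← Finset.sum_div, ← Finset.sum_div]
    gcongr
  · intro i
    have : ∀ j, A i j * (v j / r) = (A i j * z j - A i j * x j) / r := fun j => by simp only [v]; ring
    simp_rw [this]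
    rw [← Finset.sum_div, Finset.sum_sub_distrib, hz i, sub_self, zero_div]

instance (m n : ℕ) : IsProbabilityMeasure (matrixGaussian m n) := by
  unfold matrixGaussian; infer_instance

lemma gauss_tail_pos : 0 < (gaussianReal 0 1).real (Set.Iic (-3)) := by
  rw [Measure.real, ENNReal.toReal_pos_iff]
  refine ⟨pos_iff_ne_zero.2 fun h => ?_, measure_lt_top _ _⟩
  have := gaussianReal_absolutelyContinuous' 0 (one_ne_zero) h
  simp at this

lemma sqrt_gap (d1 d2 e : ℝ) (h2 : 0 ≤ d2) (h12 : d2 < d1) :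
    ∀ᶠ n : ℕ in Filter.atTop, 1 + √(d2 * n + e) ≤ √(d1 * n) := by
  have hn : Filter.Tendsto (fun n : ℕ => (n : ℝ)) Filter.atTop Filter.atTop := tendsto_natCast_atTop_atTop
  have hs : Filter.Tendsto (fun n : ℕ => √(n : ℝ)) Filter.atTop Filter.atTop :=
    Real.tendsto_sqrt_atTop.comp hn
  set d3 := (d1 + d2) / 2 with hd3
  have h3 : √d3 < √d1 := Real.sqrt_lt_sqrt (by linarith) (by linarith)
  filter_upwards [hn.eventually_ge_atTop (e / (d3 - d2)), hs.eventually_ge_atTop (1 / (√d1 - √d3))] with n a b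
  rw [div_le_iff₀ (by linarith)] at a
  rw [div_le_iff₀ (by linarith)] at b
  have h4 : √(d2 * n + e) ≤ √(d3 * n) := Real.sqrt_le_sqrt (by linarith)
  rw [Real.sqrt_mul (by linarith)] at h4
  rw [Real.sqrt_mul (by linarith)]
  linarith

theorem strong_threshold_lower_bound
    (α β : ℝ) (hα : α ∈ Set.Ioo (0 : ℝ) 1) (hβ : β ∈ Set.Ioo (0 : ℝ) 1)
    (hcond : sInf {v : ℝ | ∃ ν : ℝ, 0 ≤ ν ∧
        v = Real.sqrt ((1 + ν ^ 2) * erfc (ν / Real.sqrt 2) +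
          (4 * ν / Real.sqrt (2 * Real.pi)) *
            (2 * Real.exp (-(erfinv (1 - β)) ^ 2) - (1 / 2) * Real.exp (-ν ^ 2 / 2)))}
      < Real.sqrt α) :
    ∃ ε > (0 : ℝ), ∃ N : ℕ, ∀ n ≥ N,
      1 - ENNReal.ofReal (Real.exp (-ε * n)) ≤
        matrixGaussian (⌈α * n⌉₊) n
          {A | ∀ x : Fin n → ℝ,
            (∃ K : Finset (Fin n), K.card ≤ ⌈β * n⌉₊ ∧ ∀ i ∉ K, x i = 0) →
              UniqueL1Min A x} := by
  obtain ⟨ν, t, hν, hνt, hlt⟩ := cond_reduce α β hα hβ hcond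
  have hα0 := hα.1
  have hβ0 := hβ.1
  have ht : 0 ≤ t := hν.trans hνt
  set EY := ∫ x, Yf ν t x ∂(gaussianReal 0 1) with hEY
  have hEY0 : 0 ≤ EY := integral_nonneg fun x => (Yf_growth ν t hν ht x).1
  have hb0 : 0 ≤ 4 * ν * t * β := by positivity
  set δ := (α - (EY + 4 * ν * t * β)) / 3 with hδ
  have hδ0 : 0 < δ := by rw [hδ]; linarith
  obtain ⟨ε1, hε1, H1⟩ := chernoff (fun x => -x ^ 2) (by fun_prop) 1 one_pos
    (fun x => by rw [abs_neg, abs_of_nonneg (sq_nonneg x)]; linarith) (-((α - δ) / α)) (by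
      have h1 : ∫ x, x ^ 2 ∂(gaussianReal 0 1) = 1 := by
        have h := variance_of_integral_eq_zero (X := fun x : ℝ => x) (μ := gaussianReal 0 1)
          aemeasurable_id (by simp)
        rw [← h]
        exact variance_id_gaussianReal
      rw [integral_neg, h1]
      have : (α - δ) / α < 1 := by rw [div_lt_one hα0]; linarith
      linarith)
  obtain ⟨ε2, hε2, H2⟩ := chernoff (Yf ν t) (Yf_meas ν t) (1 + 4 * ν) (by positivity)
    (fun x => by rw [abs_of_nonneg (Yf_growth ν t hν ht x).1]; exact (Yf_growth ν t hν ht x).2)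
    (EY + δ) (by linarith)
  set ε := min (ε1 * α) ε2 / 2 with hε
  have hε0 : 0 < ε := by rw [hε]; have := mul_pos hε1 hα0; positivity
  set c := (gaussianReal 0 1).real (Set.Iic (-3)) with hc
  have hc0 : 0 < c := gauss_tail_pos
  have hbig : ∀ᶠ n : ℕ in Filter.atTop, 2 / c ≤ Real.exp (ε * n) :=
    (Real.tendsto_exp_atTop.comp (tendsto_natCast_atTop_atTop.const_mul_atTop hε0)).eventually_ge_atTop _
  obtain ⟨N, hN⟩ := Filter.eventually_atTop.1
    ((sqrt_gap (α - δ) (EY + δ + 4 * ν * t * β) (4 * ν * t) (by linarith) (by rw [hδ]; linarith)).and hbig)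
  refine ⟨ε, hε0, N, fun n hn => ?_⟩
  obtain ⟨hgap, hexp⟩ := hN n hn
  set m := ⌈α * n⌉₊ with hm
  set k := ⌈β * n⌉₊ with hk
  have hmα : α * n ≤ m := Nat.le_ceil _
  have hkβ : (k : ℝ) ≤ β * n + 1 := (Nat.ceil_lt_add_one (by positivity)).le
  set G : Set (Fin m → Fin n → ℝ) := {A | ∀ x : Fin n → ℝ,
            (∃ K : Finset (Fin n), K.card ≤ k ∧ ∀ i ∉ K, x i = 0) →
              UniqueL1Min A x} with hG
  have hesc := escape m n (badSet n k) (fun x hx => hx.1)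
    {h | -((α - δ) / α) * m ≤ ∑ i, -h i ^ 2} {g | (EY + δ) * n ≤ ∑ i, Yf ν t (g i)}
    (measurableSet_le measurable_const (by fun_prop))
    (measurableSet_le measurable_const (Finset.measurable_sum _ fun i _ =>
      (Yf_meas ν t).comp (measurable_pi_apply i)))
    (by
      intro h hh g hg w ⟨hw, K, hK, hKw⟩
      rw [Set.mem_ofPred_eq, not_le, Finset.sum_neg_distrib] at hh
      rw [Set.mem_ofPred_eq, not_le] at hg
      have hwb := width_bound ν t hν hνt k g w hw K hK hKw
      have h1 : (α - δ) * n ≤ ∑ i, h i ^ 2 := by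
        have hpos : 0 ≤ (α - δ) / α := div_nonneg (by rw [hδ]; linarith) hα0.le
        have h2 := mul_le_mul_of_nonneg_left hmα hpos
        have h3 : (α - δ) / α * (α * n) = (α - δ) * n := by field_simp
        linarith
      have h2 : ∑ j, Yf ν t (g j) + 4 * ν * t * k ≤ (EY + δ + 4 * ν * t * β) * n + 4 * ν * t := by
        have h5 : 0 ≤ 4 * ν * t := by positivity
        nlinarith [mul_le_mul_of_nonneg_left hkβ h5]
      have h3 := Real.sqrt_le_sqrt h1
      have h4 := Real.sqrt_le_sqrt h2
      linarith)
  have hsub : Gᶜ ⊆ {A | ∃ x ∈ badSet n k, ∀ i, ∑ j, A i j * x j = 0} := fun A hA => fail_bad k A hA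
  have hbad : matrixGaussian m n Gᶜ ≤ ENNReal.ofReal (Real.exp (-ε * n)) := by
    rw [ENNReal.le_ofReal_iff_toReal_le (measure_ne_top _ _) (Real.exp_pos _).le]
    have h1 : gaussianReal 0 1 (Set.Iic (-3)) * matrixGaussian m n Gᶜ ≤
        ENNReal.ofReal (Real.exp (-ε1 * m)) + ENNReal.ofReal (Real.exp (-ε2 * n)) :=
      (mul_le_mul_right (measure_mono hsub) _).trans (hesc.trans (add_le_add (H1 m) (H2 n)))
    rw [← ENNReal.ofReal_add (Real.exp_pos _).le (Real.exp_pos _).le,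
      ENNReal.le_ofReal_iff_toReal_le (ENNReal.mul_ne_top (measure_ne_top _ _) (measure_ne_top _ _))
        (by positivity), ENNReal.toReal_mul] at h1
    change c * _ ≤ _ at h1
    have hn0 : (0:ℝ) ≤ n := Nat.cast_nonneg n
    have h2 : Real.exp (-ε1 * m) ≤ Real.exp (-ε * n) * Real.exp (-ε * n) := by
      rw [← Real.exp_add, Real.exp_le_exp]
      have a1 : min (ε1 * α) ε2 ≤ ε1 * α := min_le_left _ _
      have a2 := mul_le_mul_of_nonneg_left hmα hε1.le
      have a3 := mul_le_mul_of_nonneg_right a1 hn0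
      rw [hε]
      linarith
    have h3 : Real.exp (-ε2 * n) ≤ Real.exp (-ε * n) * Real.exp (-ε * n) := by
      rw [← Real.exp_add, Real.exp_le_exp]
      have a1 : min (ε1 * α) ε2 ≤ ε2 := min_le_right _ _
      have a3 := mul_le_mul_of_nonneg_right a1 hn0
      rw [hε]
      linarith
    have h4 : 2 * Real.exp (-ε * n) ≤ c := by
      rw [div_le_iff₀ hc0] at hexp
      have h5 : Real.exp (ε * n) * Real.exp (-ε * n) = 1 := by
        rw [← Real.exp_add]; simp
      have h6 := mul_le_mul_of_nonneg_right hexp (Real.exp_pos (-ε * n)).le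
      calc _ ≤ _ := h6
        _ = c * (Real.exp (ε * n) * Real.exp (-ε * n)) := by ring
        _ = c := by rw [h5, mul_one]
    have h7 : c * (matrixGaussian m n Gᶜ).toReal ≤ c * Real.exp (-ε * n) := by
      have := mul_le_mul_of_nonneg_right h4 (Real.exp_pos (-ε * n)).le
      linarith
    exact le_of_mul_le_mul_left h7 hc0
  rw [tsub_le_iff_right]
  calc (1 : ENNReal) = matrixGaussian m n Set.univ := measure_univ.symm
    _ = matrixGaussian m n (G ∪ Gᶜ) := by rw [Set.union_compl_self]
    _ ≤ matrixGaussian m n G + matrixGaussian m n Gᶜ := measure_union_le _ _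
    _ ≤ _ := by gcongr
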